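/- arXiv:2307.15288 — 10 statements merged into one kernel-verified Lean document; each statement's English description precedes it below -/
import Mathlib

section
/- Let t_f > 0 and L > 0, let 𝒰 ⊆ ℝⁿ, and let F : [0,t_f] × ℝⁿ → ℝⁿ be such that for every t ∈ [0,t_f] the map y ↦ F(t,y) is Lipschitz with constant L on 𝒰. Let x_P : [0,t_f] → ℝⁿ be continuously differentiable, and let x̂ : [0,t_f] → ℝⁿ be continuously differentiable with x̂(0) = x_P(0) and x̂'(t) = F(t, x̂(t)) for all t ∈ [0,t_f]. Assume x_P(t) ∈ 𝒰 and x̂(t) ∈ 𝒰 for all t ∈ [0,t_f], and that t ↦ F(t,x_P(t)) and t ↦ F(t,x̂(t)) are integrable on [0,t_f]. Then ∫₀^{t_f} ‖x_P(t) − x̂(t)‖² dt ≤ ∫₀^{t_f} w_{L,t_f}(t) ‖x_P'(t) − F(t, x_P(t))‖² dt, where w_{L,t_f}(t) = (1/(4L²))[(e^{2L t_f} − 2L t_f) − (e^{2L t} − 2L t)]. -/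
open MeasureTheory Set Real

lemma integrableOn_norm_sub_sq_of_norm_sub_le {V : Type*} [NormedAddCommGroup V] {a b : ℝ}
    {p q G c : ℝ → V} {K : ℝ} (hp : ContinuousOn p (Icc a b)) (hq : ContinuousOn q (Icc a b))
    (hc : ContinuousOn c (Icc a b)) (hG : IntegrableOn G (Icc a b))
    (hGq : ∀ t ∈ Icc a b, ‖G t - q t‖ ≤ K * ‖c t‖) :
    IntegrableOn (fun t => ‖p t - G t‖ ^ 2) (Icc a b) := by
  have hbd : ContinuousOn (fun t => (‖p t - q t‖ + K * ‖c t‖) ^ 2) (Icc a b) := by fun_prop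
  refine Integrable.mono' (hbd.integrableOn_compact isCompact_Icc)
    (((hp.integrableOn_compact isCompact_Icc).sub hG).aestronglyMeasurable.norm.pow 2) ?_
  refine ae_restrict_of_forall_mem measurableSet_Icc fun t ht => ?_
  rw [norm_pow, norm_norm]
  gcongr
  calc ‖p t - G t‖ = ‖(p t - q t) - (G t - q t)‖ := by congr 1; abel
    _ ≤ ‖p t - q t‖ + ‖G t - q t‖ := norm_sub_le _ _
    _ ≤ _ := by gcongr; exact hGq t ht

/-- A function that is `o(t)` at `0`, divided by a function that dominates `t`, is continuous at
`0` from the right. -/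
lemma continuousWithinAt_div_of_hasDerivAt_zero {E a : ℝ → ℝ} (hE : HasDerivAt E 0 0)
    (hE0 : E 0 = 0) (ha : ∀ t, 0 ≤ t → t ≤ a t) :
    ContinuousWithinAt (fun t => E t / a t) (Ici 0) 0 := by
  have hlo : E =o[nhds 0] fun t : ℝ => t := by
    simpa [hasDerivAt_iff_isLittleO, hE0] using hE
  have hdiv : Filter.Tendsto (fun t => E t / t) (nhds 0) (nhds 0) := hlo.tendsto_div_nhds_zero
  unfold ContinuousWithinAt
  simp only [hE0, zero_div]
  refine squeeze_zero_norm' ?_ (by simpa using (hdiv.mono_left nhdsWithin_le_nhds).norm)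
  filter_upwards [self_mem_nhdsWithin] with t ht
  rcases (mem_Ici.mp ht).eq_or_lt with rfl | ht
  · simp [hE0]
  rw [norm_div, Real.norm_of_nonneg (ht.le.trans (ha t ht.le)), abs_of_pos ht]
  exact div_le_div_of_nonneg_left (norm_nonneg _) ht (ha t ht.le)

/-- Differential inequality for the weighted quotient `w E / a`, where `w' = -a`,
`a' = 1 + 2 L a` and `E = N ^ 2` satisfies `E' ≤ 2 N ρ + 2 L N ^ 2`. -/
lemma weighted_quotient_deriv_le {L a w N ρ E' : ℝ} (ha : 0 < a) (hw : 0 ≤ w)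
    (hE' : E' ≤ 2 * N * ρ + 2 * L * N ^ 2) :
    -a * (N ^ 2 / a) + w * ((E' * a - N ^ 2 * (1 + 2 * L * a)) / a ^ 2) ≤
      w * ρ ^ 2 - N ^ 2 := by
  have h1 : (E' * a - N ^ 2 * (1 + 2 * L * a)) / a ^ 2 ≤ ρ ^ 2 := by
    rw [div_le_iff₀ (by positivity)]
    nlinarith [mul_le_mul_of_nonneg_right hE' ha.le, sq_nonneg (N - a * ρ)]
  have h2 : -a * (N ^ 2 / a) = -N ^ 2 := by field_simp
  linarith [mul_le_mul_of_nonneg_left h1 hw]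

/-- Proposition 1 (weighted velocity projection error). -/
theorem weighted_velocity_projection_error
    (n : ℕ) (tf L : ℝ) (htf : 0 < tf) (hL : 0 < L)
    (U : Set (EuclideanSpace ℝ (Fin n)))
    (F : ℝ → EuclideanSpace ℝ (Fin n) → EuclideanSpace ℝ (Fin n))
    (hFLip : ∀ t ∈ Icc (0:ℝ) tf, ∀ y ∈ U, ∀ z ∈ U,
      ‖F t y - F t z‖ ≤ L * ‖y - z‖)
    (xP xP' xh xh' : ℝ → EuclideanSpace ℝ (Fin n))
    (hxP : ∀ t ∈ Icc (0:ℝ) tf, HasDerivAt xP (xP' t) t)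
    (hxP' : ContinuousOn xP' (Icc (0:ℝ) tf))
    (hxh : ∀ t ∈ Icc (0:ℝ) tf, HasDerivAt xh (xh' t) t)
    (hxh' : ContinuousOn xh' (Icc (0:ℝ) tf))
    (hinit : xh 0 = xP 0)
    (hODE : ∀ t ∈ Icc (0:ℝ) tf, xh' t = F t (xh t))
    (hxPU : ∀ t ∈ Icc (0:ℝ) tf, xP t ∈ U)
    (hxhU : ∀ t ∈ Icc (0:ℝ) tf, xh t ∈ U)
    (hintP : IntervalIntegrable (fun t => F t (xP t)) volume 0 tf)
    (hinth : IntervalIntegrable (fun t => F t (xh t)) volume 0 tf) :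
    ∫ t in (0:ℝ)..tf, ‖xP t - xh t‖ ^ 2 ≤
      ∫ t in (0:ℝ)..tf,
        (1 / (4 * L ^ 2)) *
          ((Real.exp (2 * L * tf) - 2 * L * tf) - (Real.exp (2 * L * t) - 2 * L * t)) *
          ‖xP' t - F t (xP t)‖ ^ 2 := by
  set a : ℝ → ℝ := fun t => (Real.exp (2 * L * t) - 1) / (2 * L) with ha_def
  set w : ℝ → ℝ := fun t => (1 / (4 * L ^ 2)) *
    ((Real.exp (2 * L * tf) - 2 * L * tf) - (Real.exp (2 * L * t) - 2 * L * t)) with hw_def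
  have hexp : ∀ t, HasDerivAt (fun t => Real.exp (2 * L * t)) (Real.exp (2 * L * t) * (2 * L)) t :=
    fun t => by simpa using ((hasDerivAt_id t).const_mul (2 * L)).exp
  have ha : ∀ t, HasDerivAt a (1 + 2 * L * a t) t := fun t => by
    refine (((hexp t).sub_const 1).div_const (2 * L)).congr_deriv ?_
    simp only [ha_def]; field_simp; ring
  have hw : ∀ t, HasDerivAt w (-a t) t := fun t => by
    have hlin : HasDerivAt (fun t => 2 * L * t) (2 * L) t := by
      simpa using (hasDerivAt_id t).const_mul (2 * L)
    refine ((((hexp t).sub hlin).const_sub _).const_mul (1 / (4 * L ^ 2))).congr_deriv ?_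
    simp only [ha_def]; field_simp; ring
  have ha_ge : ∀ t, 0 ≤ t → t ≤ a t := fun t _ => by
    simp only [ha_def]
    rw [le_div_iff₀ (by positivity)]
    linarith [Real.add_one_le_exp (2 * L * t)]
  have hw_cont : Continuous w := continuous_iff_continuousAt.2 fun t => (hw t).continuousAt
  have hw_anti : AntitoneOn w (Ici 0) := by
    refine antitoneOn_of_hasDerivWithinAt_nonpos (convex_Ici 0) hw_cont.continuousOn
      (fun t _ => (hw t).hasDerivWithinAt) fun t ht => ?_
    have ht0 : 0 ≤ t := interior_subset ht
    linarith [ha_ge t ht0]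
  have hw_tf : w tf = 0 := by simp [hw_def]
  have hw_nonneg : ∀ t ∈ Icc (0:ℝ) tf, 0 ≤ w t := fun t ht =>
    hw_tf ▸ hw_anti (mem_Ici.2 ht.1) (mem_Ici.2 htf.le) ht.2
  set e : ℝ → EuclideanSpace ℝ (Fin n) := fun t => xP t - xh t with he_def
  have he : ∀ t ∈ Icc (0:ℝ) tf, HasDerivAt e (xP' t - xh' t) t := fun t ht =>
    (hxP t ht).sub (hxh t ht)
  have hE : ∀ t ∈ Icc (0:ℝ) tf, HasDerivAt (fun t => ‖e t‖ ^ 2)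
      (2 * inner ℝ (e t) (xP' t - xh' t)) t := fun t ht => (he t ht).norm_sq
  have he0 : e 0 = 0 := by simp [he_def, hinit]
  have he_cont : ContinuousOn e (Icc 0 tf) := fun t ht => (he t ht).continuousAt.continuousWithinAt
  have hlip : ∀ t ∈ Icc (0:ℝ) tf, ‖F t (xP t) - xh' t‖ ≤ L * ‖e t‖ := fun t ht => by
    rw [hODE t ht]; exact hFLip t ht _ (hxPU t ht) _ (hxhU t ht)
  have hρ : IntegrableOn (fun t => ‖xP' t - F t (xP t)‖ ^ 2) (Icc 0 tf) :=
    integrableOn_norm_sub_sq_of_norm_sub_le hxP' hxh' he_cont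
      ((intervalIntegrable_iff_integrableOn_Icc_of_le htf.le).1 hintP) hlip
  have hwρ : IntegrableOn (fun t => w t * ‖xP' t - F t (xP t)‖ ^ 2) (Icc 0 tf) :=
    hρ.continuousOn_mul hw_cont.continuousOn isCompact_Icc
  have hEint : IntegrableOn (fun t => ‖e t‖ ^ 2) (Icc 0 tf) :=
    (he_cont.norm.pow 2).integrableOn_compact isCompact_Icc
  have hquot : ∀ t ∈ Ioc (0:ℝ) tf, HasDerivAt (fun t => w t * (‖e t‖ ^ 2 / a t))
      (-a t * (‖e t‖ ^ 2 / a t) + w t * ((2 * inner ℝ (e t) (xP' t - xh' t) * a t -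
        ‖e t‖ ^ 2 * (1 + 2 * L * a t)) / a t ^ 2)) t := fun t ht =>
    (hw t).mul ((hE t ⟨ht.1.le, ht.2⟩).div (ha t) (ht.1.trans_le (ha_ge t ht.1.le)).ne')
  have hcont : ContinuousOn (fun t => w t * (‖e t‖ ^ 2 / a t)) (Icc 0 tf) := fun t ht => by
    rcases ht.1.eq_or_lt with rfl | ht0
    · refine hw_cont.continuousWithinAt.mul
        ((continuousWithinAt_div_of_hasDerivAt_zero ?_ (by simp [he0]) ha_ge).mono Icc_subset_Ici_self)
      simpa [he0] using hE 0 ht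
    · exact (hquot t ⟨ht0, ht.2⟩).continuousAt.continuousWithinAt
  have key := intervalIntegral.sub_le_integral_of_hasDeriv_right_of_le htf.le hcont
    (fun t ht => (hquot t ⟨ht.1, ht.2.le⟩).hasDerivWithinAt) (hwρ.sub hEint) fun t ht => by
      have ht' := Ioo_subset_Icc_self ht
      refine weighted_quotient_deriv_le (ht.1.trans_le (ha_ge t ht.1.le)) (hw_nonneg t ht') ?_
      have hdec : ‖xP' t - xh' t‖ ≤ ‖xP' t - F t (xP t)‖ + L * ‖e t‖ :=
        (norm_sub_le_norm_sub_add_norm_sub _ _ _).trans (by gcongr; exact hlip t ht')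
      nlinarith [real_inner_le_norm (e t) (xP' t - xh' t),
        mul_le_mul_of_nonneg_left hdec (norm_nonneg (e t))]
  simp only [hw_tf, he0, norm_zero, Pi.sub_apply] at key
  rw [intervalIntegral.integral_sub
    ((intervalIntegrable_iff_integrableOn_Icc_of_le htf.le).2 hwρ)
    ((intervalIntegrable_iff_integrableOn_Icc_of_le htf.le).2 hEint)] at key
  norm_num at key
  exact key
end

section
/- Let n ≥ r ≥ 1 and let Φ, Ψ ∈ ℝ^{n×r} satisfy Ψᵀ Φ = I_r. Then ‖Φ‖_F² + ‖Ψ‖_F² ≥ 2r, and equality holds if and only if Φ = Ψ and Φᵀ Φ = I_r (i.e., Φ = Ψ has orthonormal columns). -/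
open Matrix Finset

/-- The squared Frobenius norm of a real matrix. -/
def frobSq {n r : ℕ} (M : Matrix (Fin n) (Fin r) ℝ) : ℝ :=
  ∑ i, ∑ j, (M i j) ^ 2

theorem frobSq_nonneg {n r : ℕ} (M : Matrix (Fin n) (Fin r) ℝ) : 0 ≤ frobSq M :=
  sum_nonneg fun _ _ => sum_nonneg fun _ _ => sq_nonneg _

theorem frobSq_eq_zero_iff {n r : ℕ} {M : Matrix (Fin n) (Fin r) ℝ} :
    frobSq M = 0 ↔ M = 0 := by
  refine ⟨fun h => ?_, fun h => by simp [h, frobSq]⟩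
  ext i j
  have hrow := (sum_eq_zero_iff_of_nonneg fun i _ =>
    sum_nonneg fun j _ => sq_nonneg (M i j)).1 h i (mem_univ i)
  have hentry := (sum_eq_zero_iff_of_nonneg fun j _ => sq_nonneg (M i j)).1 hrow j (mem_univ j)
  exact pow_eq_zero_iff two_ne_zero |>.1 hentry

theorem frobSq_add_frobSq {n r : ℕ} (A B : Matrix (Fin n) (Fin r) ℝ) :
    frobSq A + frobSq B = frobSq (A - B) + 2 * (Bᵀ * A).trace := by
  have htrace : (Bᵀ * A).trace = ∑ i, ∑ j, B i j * A i j := by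
    rw [sum_comm]
    rfl
  rw [htrace]
  simp only [frobSq, mul_sum, ← sum_add_distrib, Matrix.sub_apply]
  exact sum_congr rfl fun i _ => sum_congr rfl fun j _ => by ring

/-- Theorem 3 (orthogonality-promoting regularization), main part. -/
theorem orthogonality_promoting_regularization
    (n r : ℕ) (hrn : r ≤ n) (hr : 1 ≤ r)
    (Φ Ψ : Matrix (Fin n) (Fin r) ℝ)
    (hbio : Ψᵀ * Φ = 1) :
    2 * (r : ℝ) ≤ frobSq Φ + frobSq Ψ ∧
      (frobSq Φ + frobSq Ψ = 2 * (r : ℝ) ↔ (Φ = Ψ ∧ Φᵀ * Φ = 1)) := by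
  have hsum : frobSq Φ + frobSq Ψ = frobSq (Φ - Ψ) + 2 * (r : ℝ) := by
    rw [frobSq_add_frobSq, hbio, trace_one, Fintype.card_fin]
  rw [hsum, add_eq_right, frobSq_eq_zero_iff, sub_eq_zero]
  refine ⟨le_add_of_nonneg_left (frobSq_nonneg _), fun h => ⟨h, ?_⟩, And.left⟩
  rwa [← h] at hbio
end

section
/- Let n ≥ r ≥ 1 and let U ∈ ℝ^{n×r} satisfy Uᵀ U = I_r. Then ‖U‖_{1,2} := Σ_{i=1}^n ‖row_i(U)‖₂ ≥ r, and equality holds if and only if U has exactly r nonzero rows. -/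
open Matrix Finset

/-- The `(1,2)`-norm of a real matrix: the sum of the Euclidean norms of its rows. -/
noncomputable def norm12 {n r : ℕ} (M : Matrix (Fin n) (Fin r) ℝ) : ℝ :=
  ∑ i, Real.sqrt (∑ j, (M i j) ^ 2)

/-- For a matrix with orthonormal columns, the squared Euclidean norms of the rows sum to the
number of columns. -/
theorem sum_sum_sq_of_transpose_mul_self_eq_one {ι κ : Type*} [Fintype ι] [Fintype κ]
    [DecidableEq κ] {U : Matrix ι κ ℝ} (hU : Uᵀ * U = 1) :
    ∑ i, ∑ j, U i j ^ 2 = Fintype.card κ := by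
  rw [Finset.sum_comm, ← trace_one (n := κ) (R := ℝ), ← hU]
  simp [trace, mul_apply, sq]

/-- The rows of a matrix with orthonormal columns have Euclidean norm at most one. -/
theorem sum_sq_row_le_one_of_transpose_mul_self_eq_one {ι κ : Type*} [Fintype ι] [Fintype κ]
    [DecidableEq κ] {U : Matrix ι κ ℝ} (hU : Uᵀ * U = 1) (i : ι) :
    ∑ j, U i j ^ 2 ≤ 1 := by
  set P := U * Uᵀ with hP
  have hPP : P * Pᵀ = P := by
    rw [hP, transpose_mul, transpose_transpose, Matrix.mul_assoc, ← Matrix.mul_assoc Uᵀ, hU,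
      Matrix.one_mul]
  have hdiag : ∑ j, U i j ^ 2 = P i i := by simp [hP, mul_apply, sq]
  have hsum : ∑ k, P i k ^ 2 = P i i := by
    conv_rhs => rw [← hPP]
    simp [mul_apply, sq]
  have hle : P i i ^ 2 ≤ P i i := by
    conv_rhs => rw [← hsum]
    exact Finset.single_le_sum (f := fun k => P i k ^ 2) (fun k _ => sq_nonneg _) (mem_univ i)
  rw [hdiag]
  nlinarith

/-- For weights in `[0, 1]`, the square roots have the same sum as the weights if and only if
the weights sum to the number of nonzero ones. -/
theorem sum_sqrt_eq_sum_iff_ncard_support {ι : Type*} [Fintype ι] {f : ι → ℝ}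
    (h₀ : ∀ i, 0 ≤ f i) (h₁ : ∀ i, f i ≤ 1) :
    ∑ i, √(f i) = ∑ i, f i ↔ (f.support.ncard : ℝ) = ∑ i, f i := by
  classical
  have hcard : (f.support.ncard : ℝ) = ∑ i, if f i = 0 then (0 : ℝ) else 1 := by
    simp [Set.ncard_eq_toFinset_card', Finset.sum_ite, Function.support]
  have hind (i : ι) : f i ≤ if f i = 0 then (0 : ℝ) else 1 := by
    split_ifs with h
    exacts [h.le, h₁ i]
  have hsqrt (i : ι) : f i ≤ √(f i) := Real.le_sqrt_of_sq_le (by nlinarith [h₀ i, h₁ i])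
  rw [hcard, eq_comm, Finset.sum_eq_sum_iff_of_le fun i _ => hsqrt i, eq_comm (b := ∑ i, f i),
    Finset.sum_eq_sum_iff_of_le fun i _ => hind i]
  refine forall₂_congr fun i _ => ?_
  split_ifs with h
  · simp [h]
  · rw [eq_comm, Real.sqrt_eq_iff_mul_self_eq (h₀ i) (h₀ i), left_eq_mul₀ h]

/-- Theorem 4 (minimizers of the sparsity-promoting penalty), core content:
for a matrix with orthonormal columns, the sum of Euclidean row norms is at least `r`,
with equality iff the matrix has exactly `r` nonzero rows. -/
theorem sparsity_penalty_minimizers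
    (n r : ℕ) (hrn : r ≤ n) (hr : 1 ≤ r)
    (U : Matrix (Fin n) (Fin r) ℝ) (hU : Uᵀ * U = 1) :
    (r : ℝ) ≤ norm12 U ∧
      (norm12 U = (r : ℝ) ↔ {i : Fin n | U i ≠ 0}.ncard = r) := by
  have hsum : ∑ i, ∑ j, U i j ^ 2 = (r : ℝ) := by
    simpa using sum_sum_sq_of_transpose_mul_self_eq_one hU
  have h₀ (i : Fin n) : 0 ≤ ∑ j, U i j ^ 2 := Finset.sum_nonneg fun j _ => sq_nonneg _
  have h₁ := sum_sq_row_le_one_of_transpose_mul_self_eq_one hU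
  have hsupp : {i : Fin n | U i ≠ 0} = (fun i => ∑ j, U i j ^ 2).support := by
    ext i
    simp [Finset.sum_eq_zero_iff_of_nonneg, sq_nonneg, funext_iff]
  constructor
  · rw [← hsum, norm12]
    exact Finset.sum_le_sum fun i _ => Real.le_sqrt_of_sq_le (by nlinarith [h₀ i, h₁ i])
  · have := sum_sqrt_eq_sum_iff_ncard_support h₀ h₁
    rwa [hsum, ← hsupp, Nat.cast_inj] at this
end

section
/- Let n ≥ r ≥ 1, let U ∈ ℝ^{n×r} satisfy Uᵀ U = I_r, let D ∈ ℝ^{n×n} be the diagonal matrix with D_{ii} = ‖row_i(U)‖₂, and suppose there is a symmetric matrix Λ ∈ ℝ^{r×r} such that D U = U Λ. If U has more than r nonzero rows, then there exist a set S of at least two row indices, a number λ ≠ 0, and coefficients c_i ≠ 0 for i ∈ S, such that ‖row_i(U)‖₂ = λ for every i ∈ S and Σ_{i∈S} c_i row_i(U) = 0; that is, U has a linearly dependent set of rows with identical nonzero Euclidean norms. -/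
open Matrix Finset

/-- If `∑ i ∈ t, c i • v i = 0` where `v i` lies in the eigenspace of `f` for `d i`, then the
part of the sum belonging to any single eigenvalue already vanishes. -/
theorem Module.End.sum_filter_smul_eq_zero {ι K V : Type*} [Field K] [DecidableEq K]
    [AddCommGroup V] [Module K V] (f : Module.End K V) (t : Finset ι) (v : ι → V) (d c : ι → K)
    (hv : ∀ i ∈ t, f (v i) = d i • v i) (hsum : ∑ i ∈ t, c i • v i = 0) (μ : K) :
    ∑ i ∈ t with d i = μ, c i • v i = 0 := by
  by_cases hμ : μ ∈ t.image d
  · refine (iSupIndep_iff_finsetSum_eq_zero_imp_eq_zero _).1 f.eigenspaces_iSupIndep (t.image d)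
      (fun ν => ∑ i ∈ t with d i = ν, c i • v i) (fun ν _ => Submodule.sum_mem _ fun i hi => ?_)
      ?_ μ hμ
    · obtain ⟨hit, rfl⟩ := Finset.mem_filter.1 hi
      exact Submodule.smul_mem _ _ (Module.End.mem_eigenspace_iff.2 (hv i hit))
    · rw [Finset.sum_fiberwise_of_maps_to fun i hi => Finset.mem_image_of_mem d hi, hsum]
  · refine Finset.sum_eq_zero fun i hi => ?_
    obtain ⟨hit, rfl⟩ := Finset.mem_filter.1 hi
    exact absurd (Finset.mem_image_of_mem d hit) hμ

/-- Technical lemma in the proof of Theorem 4: a Stiefel matrix satisfying the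
first-order optimality condition `D U = U Λ` (with `D` the diagonal matrix of row norms
and `Λ` symmetric) and having more than `r` nonzero rows has a linearly dependent
set of rows with identical nonzero Euclidean norms. -/
theorem optimality_linear_dependent_rows
    (n r : ℕ) (hrn : r ≤ n) (hr : 1 ≤ r)
    (U : Matrix (Fin n) (Fin r) ℝ) (hU : Uᵀ * U = 1)
    (D : Matrix (Fin n) (Fin n) ℝ)
    (hD : D = Matrix.diagonal (fun i => Real.sqrt (∑ j, (U i j) ^ 2)))
    (Λ : Matrix (Fin r) (Fin r) ℝ) (hΛsymm : Λᵀ = Λ)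
    (hopt : D * U = U * Λ)
    (hrows : r < {i : Fin n | U i ≠ 0}.ncard) :
    ∃ (S : Finset (Fin n)) (lam : ℝ) (c : Fin n → ℝ),
      2 ≤ S.card ∧ lam ≠ 0 ∧ (∀ i ∈ S, c i ≠ 0) ∧
        (∀ i ∈ S, Real.sqrt (∑ j, (U i j) ^ 2) = lam) ∧
        ∑ i ∈ S, c i • U i = 0 := by
  classical
  set d : Fin n → ℝ := fun i => Real.sqrt (∑ j, (U i j) ^ 2) with hd
  have heig : ∀ i, Λ.vecMulLinear (U i) = d i • U i := by
    intro i
    ext j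
    have h := congrFun (congrFun hopt i) j
    rw [hD, Matrix.diagonal_mul] at h
    exact h.symm
  set t : Finset (Fin n) := {i | U i ≠ 0} with ht
  have hcard : r < t.card := by
    rwa [← Set.ncard_coe_finset, ht, Finset.coe_filter_univ]
  obtain ⟨c, hsum, i₀, hi₀, hc₀⟩ :
      ∃ c : Fin n → ℝ, ∑ i ∈ t, c i • U i = 0 ∧ ∃ i ∈ t, c i ≠ 0 := by
    have hdep : ¬ LinearIndepOn ℝ (fun i => U i) (t : Set (Fin n)) := by
      intro h
      have hle : t.card ≤ r := by simpa using LinearIndependent.fintype_card_le_finrank h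
      omega
    rw [linearIndepOn_finset_iff] at hdep
    push Not at hdep
    exact hdep
  have hU₀ : U i₀ ≠ 0 := (Finset.mem_filter.1 hi₀).2
  have hS : ∑ i ∈ t with d i = d i₀ ∧ c i ≠ 0, c i • U i = 0 := by
    rw [← Finset.filter_filter, Finset.sum_filter_of_ne]
    · exact Module.End.sum_filter_smul_eq_zero Λ.vecMulLinear t (fun i => U i) d c
        (fun i _ => heig i) hsum (d i₀)
    · intro i _ h hc
      exact h (by rw [hc, zero_smul])
  have hmem : i₀ ∈ t.filter fun i => d i = d i₀ ∧ c i ≠ 0 := by simp [hi₀, hc₀]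
  refine ⟨t.filter fun i => d i = d i₀ ∧ c i ≠ 0, d i₀, c, ?_, ?_,
    fun i hi => (Finset.mem_filter.1 hi).2.2, fun i hi => (Finset.mem_filter.1 hi).2.1, hS⟩
  · by_contra! hlt
    have heq := Finset.eq_singleton_iff_unique_mem.2
      ⟨hmem, fun i hi => Finset.card_le_one.1 (Nat.le_of_lt_succ hlt) i hi i₀ hmem⟩
    rw [heq, Finset.sum_singleton] at hS
    exact (smul_ne_zero hc₀ hU₀) hS
  · intro h0
    apply hU₀
    rw [hd, Real.sqrt_eq_zero (Finset.sum_nonneg fun j _ => sq_nonneg _),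
      Finset.sum_eq_zero_iff_of_nonneg fun j _ => sq_nonneg _] at h0
    ext j
    simpa using h0 j (Finset.mem_univ j)
end

section
/- Let n ≥ r ≥ 1, let U_* ∈ ℝ^{n×r} satisfy U_*ᵀ U_* = I_r and have exactly r nonzero rows, and let ξ ∈ ℝ^{n×r} satisfy U_*ᵀ ξ = 0. Write ξ = U Σ Vᵀ where U ∈ ℝ^{n×r} with Uᵀ U = I_r, Σ = diag(σ₁,…,σ_r) with σ_i ≥ 0, and V ∈ ℝ^{r×r} orthogonal; define Φ = U_* V cos(Σ) Vᵀ + U sin(Σ) Vᵀ, where cos(Σ) and sin(Σ) are the diagonal matrices with entries cos(σ_i) and sin(σ_i). Then | (‖Φ‖_{1,2} − r) − ‖ξ‖_{1,2} | ≤ √n ( ‖ξ‖_F² / 2 + ‖ξ‖_F³ / 6 ). -/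
open Matrix Finset

/-- The Frobenius norm of a real matrix. -/
noncomputable def frobNorm {n r : ℕ} (M : Matrix (Fin n) (Fin r) ℝ) : ℝ :=
  Real.sqrt (∑ i, ∑ j, (M i j) ^ 2)

lemma sqrt_sum_sq_eq_norm {r : ℕ} (x : Fin r → ℝ) :
    Real.sqrt (∑ j, x j ^ 2) = ‖WithLp.toLp 2 x‖ := by
  simp [EuclideanSpace.norm_eq]

lemma abs_norm12_sub_norm12_le {n r : ℕ} (A B : Matrix (Fin n) (Fin r) ℝ) :
    |norm12 A - norm12 B| ≤ norm12 (A - B) := by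
  unfold norm12
  rw [← Finset.sum_sub_distrib]
  refine (Finset.abs_sum_le_sum_abs _ _).trans (Finset.sum_le_sum fun i _ => ?_)
  rw [sqrt_sum_sq_eq_norm, sqrt_sum_sq_eq_norm, sqrt_sum_sq_eq_norm]
  exact abs_norm_sub_norm_le (WithLp.toLp 2 (A i)) (WithLp.toLp 2 (B i))

lemma norm12_le_sqrt_mul_frobNorm {n r : ℕ} (A : Matrix (Fin n) (Fin r) ℝ) :
    norm12 A ≤ Real.sqrt n * frobNorm A := by
  unfold norm12 frobNorm
  rw [← Real.sqrt_mul (Nat.cast_nonneg n)]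
  apply Real.le_sqrt_of_sq_le
  refine sq_sum_le_card_mul_sum_sq.trans_eq ?_
  rw [Finset.card_univ, Fintype.card_fin]
  congr 1
  exact Finset.sum_congr rfl fun i _ =>
    Real.sq_sqrt (Finset.sum_nonneg fun j _ => sq_nonneg _)

lemma norm12_add_of_disjoint_rows {n r : ℕ} {A B : Matrix (Fin n) (Fin r) ℝ}
    (h : ∀ i, A i = 0 ∨ B i = 0) : norm12 (A + B) = norm12 A + norm12 B := by
  unfold norm12
  rw [← Finset.sum_add_distrib]
  refine Finset.sum_congr rfl fun i _ => ?_
  rcases h i with h | h <;> simp [Matrix.add_apply, h]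

lemma frobNorm_mul_diagonal_mul_transpose {n r : ℕ} {P : Matrix (Fin n) (Fin r) ℝ}
    (hP : Pᵀ * P = 1) {V : Matrix (Fin r) (Fin r) ℝ} (hV : Vᵀ * V = 1) (d : Fin r → ℝ) :
    frobNorm (P * Matrix.diagonal d * Vᵀ) = Real.sqrt (∑ k, d k ^ 2) := by
  have htr : ∀ M : Matrix (Fin n) (Fin r) ℝ, ∑ i, ∑ j, M i j ^ 2 = (Mᵀ * M).trace := by
    intro M
    rw [Finset.sum_comm]
    simp [Matrix.trace, Matrix.mul_apply, sq]
  have hM : (P * Matrix.diagonal d * Vᵀ)ᵀ * (P * Matrix.diagonal d * Vᵀ)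
      = V * (Matrix.diagonal d * (Pᵀ * P) * Matrix.diagonal d * Vᵀ) := by
    simp [Matrix.transpose_mul, Matrix.mul_assoc]
  rw [frobNorm, htr, hM, Matrix.trace_mul_comm, Matrix.mul_assoc, hP, hV]
  simp [Matrix.trace, sq]

lemma frobNorm_mul_diagonal_mul_transpose_le {n r : ℕ} {P Q : Matrix (Fin n) (Fin r) ℝ}
    (hP : Pᵀ * P = 1) (hQ : Qᵀ * Q = 1) {V : Matrix (Fin r) (Fin r) ℝ} (hV : Vᵀ * V = 1)
    {d σ : Fin r → ℝ} {c : ℝ} (hc : 0 ≤ c) (hd : ∀ k, |d k| ≤ c * σ k) :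
    frobNorm (P * Matrix.diagonal d * Vᵀ) ≤ c * frobNorm (Q * Matrix.diagonal σ * Vᵀ) := by
  rw [frobNorm_mul_diagonal_mul_transpose hP hV, frobNorm_mul_diagonal_mul_transpose hQ hV]
  apply Real.sqrt_le_iff.2 ⟨by positivity, ?_⟩
  rw [mul_pow, Real.sq_sqrt (Finset.sum_nonneg fun k _ => sq_nonneg _), Finset.mul_sum]
  refine Finset.sum_le_sum fun k _ => ?_
  rw [← mul_pow, ← sq_abs (d k)]
  exact pow_le_pow_left₀ (abs_nonneg _) (hd k) 2

lemma transpose_submatrix_nonzero_rows_mul {n r s : ℕ} (W : Matrix (Fin n) (Fin r) ℝ)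
    (X : Matrix (Fin n) (Fin s) ℝ) [Fintype {i // W i ≠ 0}] :
    (W.submatrix ((↑) : {i // W i ≠ 0} → Fin n) id)ᵀ *
      X.submatrix ((↑) : {i // W i ≠ 0} → Fin n) id = Wᵀ * X := by
  classical
  ext j k
  simp only [Matrix.mul_apply, Matrix.transpose_apply, Matrix.submatrix_apply, id]
  rw [← Finset.sum_subtype (Finset.univ.filter fun i => W i ≠ 0) (by simp)
    (fun i => W i j * X i k)]
  refine Finset.sum_subset (Finset.filter_subset _ _) fun i _ hi => ?_
  have hWi : W i = 0 := by simpa using hi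
  simp [hWi]

/-- The nonzero rows of a matrix with `r` orthonormal columns and exactly `r` nonzero rows
form an orthogonal matrix. -/
lemma submatrix_nonzero_rows_mul_transpose {n r : ℕ} {W : Matrix (Fin n) (Fin r) ℝ}
    (hW : Wᵀ * W = 1) (hrows : {i : Fin n | W i ≠ 0}.ncard = r)
    [Fintype {i // W i ≠ 0}] [DecidableEq {i // W i ≠ 0}] :
    W.submatrix ((↑) : {i // W i ≠ 0} → Fin n) id *
      (W.submatrix ((↑) : {i // W i ≠ 0} → Fin n) id)ᵀ = 1 := by
  have hcard : Fintype.card {i // W i ≠ 0} = Fintype.card (Fin r) := by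
    rw [Fintype.card_fin, ← Nat.card_eq_fintype_card]
    exact hrows
  refine (Matrix.mul_eq_one_comm_of_card_eq _ _ _ hcard.symm).1 ?_
  rw [transpose_submatrix_nonzero_rows_mul, hW]

lemma norm12_eq_of_nonzero_rows {n r : ℕ} {W : Matrix (Fin n) (Fin r) ℝ}
    (hW : Wᵀ * W = 1) (hrows : {i : Fin n | W i ≠ 0}.ncard = r) : norm12 W = r := by
  classical
  have hone := submatrix_nonzero_rows_mul_transpose hW hrows
  have hrow : ∀ i, Real.sqrt (∑ j, W i j ^ 2) = if W i ≠ 0 then 1 else 0 := by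
    intro i
    split_ifs with hi
    · have h := congr_fun (congr_fun hone ⟨i, hi⟩) ⟨i, hi⟩
      simp only [Matrix.mul_apply, Matrix.transpose_apply, Matrix.submatrix_apply, id,
        Matrix.one_apply_eq, ← sq] at h
      rw [h, Real.sqrt_one]
    · rw [not_not] at hi
      simp [hi]
  simp only [norm12, hrow]
  refine (@Finset.sum_boole _ _ _ (fun i => W i ≠ 0) (fun i => inferInstance) _).trans ?_
  rw [← Set.ncard_coe_finset, Finset.coe_filter_univ, hrows]

lemma row_eq_zero_of_transpose_mul_eq_zero {n r s : ℕ} {W : Matrix (Fin n) (Fin r) ℝ}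
    (hW : Wᵀ * W = 1) (hrows : {i : Fin n | W i ≠ 0}.ncard = r)
    {X : Matrix (Fin n) (Fin s) ℝ} (hX : Wᵀ * X = 0) {i : Fin n} (hi : W i ≠ 0) :
    X i = 0 := by
  classical
  have hsub : X.submatrix ((↑) : {i // W i ≠ 0} → Fin n) id = 0 := by
    rw [← Matrix.one_mul (X.submatrix _ _), ← submatrix_nonzero_rows_mul_transpose hW hrows,
      Matrix.mul_assoc, transpose_submatrix_nonzero_rows_mul, hX, Matrix.mul_zero]
  ext j
  exact congr_fun (congr_fun hsub ⟨i, hi⟩) j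

/-- Lemma 11 (local behavior of the sparsity-promoting penalty), matrix form. -/
theorem local_behavior_sparsity_penalty
    (n r : ℕ) (hrn : r ≤ n) (hr : 1 ≤ r)
    (Ustar : Matrix (Fin n) (Fin r) ℝ) (hUstar : Ustarᵀ * Ustar = 1)
    (hUrows : {i : Fin n | Ustar i ≠ 0}.ncard = r)
    (ξ : Matrix (Fin n) (Fin r) ℝ) (hhoriz : Ustarᵀ * ξ = 0)
    (U : Matrix (Fin n) (Fin r) ℝ) (hU : Uᵀ * U = 1)
    (σ : Fin r → ℝ) (hσ : ∀ i, 0 ≤ σ i)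
    (V : Matrix (Fin r) (Fin r) ℝ) (hV : Vᵀ * V = 1)
    (hSVD : ξ = U * Matrix.diagonal σ * Vᵀ)
    (Φ : Matrix (Fin n) (Fin r) ℝ)
    (hΦ : Φ = Ustar * V * Matrix.diagonal (fun i => Real.cos (σ i)) * Vᵀ
        + U * Matrix.diagonal (fun i => Real.sin (σ i)) * Vᵀ) :
    |(norm12 Φ - (r : ℝ)) - norm12 ξ| ≤
      Real.sqrt n * (frobNorm ξ ^ 2 / 2 + frobNorm ξ ^ 3 / 6) := by
  have hVV : V * Vᵀ = 1 := mul_eq_one_comm.1 hV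
  have hUV : (Ustar * V)ᵀ * (Ustar * V) = 1 := by
    rw [Matrix.transpose_mul, Matrix.mul_assoc, ← Matrix.mul_assoc Ustarᵀ, hUstar,
      Matrix.one_mul, hV]
  set F := frobNorm ξ with hF
  have hF0 : 0 ≤ F := Real.sqrt_nonneg _
  have hσF : ∀ k, σ k ≤ F := fun k => by
    rw [hF, hSVD, frobNorm_mul_diagonal_mul_transpose hU hV]
    exact Real.le_sqrt_of_sq_le
      (Finset.single_le_sum (f := fun k => σ k ^ 2) (fun k _ => sq_nonneg _) (Finset.mem_univ k))
  set A := Ustar * V * Matrix.diagonal (fun i => Real.cos (σ i)) * Vᵀ with hA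
  set B := U * Matrix.diagonal (fun i => Real.sin (σ i)) * Vᵀ with hB
  have hξV : ξ * V = U * Matrix.diagonal σ := by
    rw [hSVD, Matrix.mul_assoc, hV, Matrix.mul_one]
  have hdisj : ∀ i, A i = 0 ∨ B i = 0 := by
    intro i
    by_cases hi : Ustar i = 0
    · left
      ext j
      simp only [hA, Matrix.mul_assoc]
      simp [Matrix.mul_apply (M := Ustar), hi]
    · right
      have hξV0 : (ξ * V) i = 0 := by
        have hξi := row_eq_zero_of_transpose_mul_eq_zero hUstar hUrows hhoriz hi
        ext k
        simp [Matrix.mul_apply, hξi]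
      ext j
      rw [hB, Matrix.mul_apply]
      refine Finset.sum_eq_zero fun k _ => ?_
      have hk : U i k * σ k = 0 := by
        have := congr_fun hξV0 k
        rwa [hξV, Matrix.mul_diagonal] at this
      rw [Matrix.mul_diagonal]
      rcases mul_eq_zero.1 hk with h | h <;> simp [h]
  have hAsub : A - Ustar
      = Ustar * V * Matrix.diagonal (fun i => Real.cos (σ i) - 1) * Vᵀ := by
    rw [← Matrix.diagonal_sub, Matrix.mul_sub, Matrix.sub_mul, Matrix.diagonal_one,
      Matrix.mul_one, Matrix.mul_assoc Ustar V Vᵀ, hVV, Matrix.mul_one]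
  have hBsub : B - ξ = U * Matrix.diagonal (fun i => Real.sin (σ i) - σ i) * Vᵀ := by
    rw [← Matrix.diagonal_sub, Matrix.mul_sub, Matrix.sub_mul, ← hSVD]
  have hAF : frobNorm (A - Ustar) ≤ F / 2 * F := by
    rw [hAsub, hF]
    nth_rewrite 2 [hSVD]
    refine frobNorm_mul_diagonal_mul_transpose_le hUV hU hV (by positivity) fun k => ?_
    rw [abs_sub_comm, abs_of_nonneg (by linarith [Real.cos_le_one (σ k)])]
    nlinarith [Real.one_sub_sq_div_two_le_cos (x := σ k), hσ k, hσF k]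
  have hBF : frobNorm (B - ξ) ≤ F ^ 2 / 6 * F := by
    rw [hBsub, hF]
    nth_rewrite 2 [hSVD]
    refine frobNorm_mul_diagonal_mul_transpose_le hU hU hV (by positivity) fun k => ?_
    have hsq : σ k ^ 2 ≤ F ^ 2 := pow_le_pow_left₀ (hσ k) (hσF k) 2
    have hsin := Real.abs_sub_sin_le (σ k)
    rw [abs_sub_comm, abs_of_nonneg (hσ k)] at hsin
    nlinarith [mul_le_mul_of_nonneg_right hsq (hσ k)]
  have hsplit : norm12 Φ - (r : ℝ) - norm12 ξ
      = (norm12 A - norm12 Ustar) + (norm12 B - norm12 ξ) := by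
    rw [hΦ, norm12_add_of_disjoint_rows hdisj, norm12_eq_of_nonzero_rows hUstar hUrows]
    ring
  rw [hsplit]
  calc |(norm12 A - norm12 Ustar) + (norm12 B - norm12 ξ)|
      ≤ norm12 (A - Ustar) + norm12 (B - ξ) :=
        (abs_add_le _ _).trans
          (add_le_add (abs_norm12_sub_norm12_le _ _) (abs_norm12_sub_norm12_le _ _))
    _ ≤ Real.sqrt n * frobNorm (A - Ustar) + Real.sqrt n * frobNorm (B - ξ) :=
        add_le_add (norm12_le_sqrt_mul_frobNorm _) (norm12_le_sqrt_mul_frobNorm _)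
    _ ≤ Real.sqrt n * (F / 2 * F) + Real.sqrt n * (F ^ 2 / 6 * F) := by gcongr
    _ = Real.sqrt n * (F ^ 2 / 2 + F ^ 3 / 6) := by ring
end

section
/- Let n ≥ r ≥ 1 and let Φ, Ψ ∈ ℝ^{n×r} satisfy Ψᵀ Φ = I_r. Endow ℝ^{n×r} × ℝ^{n×r} with the inner product ⟨(X₁,Y₁),(X₂,Y₂)⟩ = Tr(X₁ᵀ X₂) + Tr(Y₁ᵀ Y₂), and let T = {(X,Y) ∈ ℝ^{n×r}×ℝ^{n×r} : Yᵀ Φ + Ψᵀ X = 0}. Then the orthogonal complement of T equals {(Ψ A, Φ Aᵀ) : A ∈ ℝ^{r×r}}. -/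
open Matrix

/-- Theorem 7 (the biorthogonal manifold): characterization of the normal space.
With respect to the trace inner product on pairs of matrices, the orthogonal complement
of the tangent space `T = {(X,Y) : Yᵀ Φ + Ψᵀ X = 0}` equals `{(Ψ A, Φ Aᵀ) : A}`. -/
theorem biorthogonal_normal_space
    (n r : ℕ) (hrn : r ≤ n) (hr : 1 ≤ r)
    (Φ Ψ : Matrix (Fin n) (Fin r) ℝ) (hbio : Ψᵀ * Φ = 1) :
    {p : Matrix (Fin n) (Fin r) ℝ × Matrix (Fin n) (Fin r) ℝ |
        ∀ q : Matrix (Fin n) (Fin r) ℝ × Matrix (Fin n) (Fin r) ℝ,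
          q.2ᵀ * Φ + Ψᵀ * q.1 = 0 →
            Matrix.trace (p.1ᵀ * q.1) + Matrix.trace (p.2ᵀ * q.2) = 0} =
      {p : Matrix (Fin n) (Fin r) ℝ × Matrix (Fin n) (Fin r) ℝ |
        ∃ A : Matrix (Fin r) (Fin r) ℝ, p = (Ψ * A, Φ * Aᵀ)} := by
  ext ⟨P, Q⟩
  simp only [Set.mem_ofPred_eq, Prod.mk.injEq]
  constructor
  · intro h
    refine ⟨Φᵀ * P, ?_, ?_⟩
    · refine transpose_injective (Matrix.ext_iff_trace_mul_right.2 fun X => ?_)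
      have hX := h (X - Φ * (Ψᵀ * X), 0) (by
        simp [Matrix.mul_sub, ← Matrix.mul_assoc, hbio])
      simpa [Matrix.mul_sub, Matrix.mul_assoc, sub_eq_zero] using hX
    · refine transpose_injective (Matrix.ext_iff_trace_mul_right.2 fun Y => ?_)
      have hY := h (-(Φ * (Yᵀ * Φ)), Y) (by
        simp [← Matrix.mul_assoc, hbio])
      have htr : trace (Pᵀ * (Φ * (Yᵀ * Φ))) = trace (Φᵀ * P * Φᵀ * Y) := by
        rw [← trace_transpose, Matrix.mul_assoc (Φᵀ * P), trace_mul_comm (Φᵀ * P)]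
        simp [Matrix.mul_assoc]
      simp only [transpose_mul, transpose_transpose]
      rw [← htr]
      simp only [Matrix.mul_neg, trace_neg] at hY
      linarith
  · rintro ⟨A, rfl, rfl⟩ ⟨X, Y⟩ hq
    have htr : trace ((Φ * Aᵀ)ᵀ * Y) = trace (Aᵀ * (Yᵀ * Φ)) := by
      rw [← trace_transpose, trace_mul_comm Aᵀ]
      simp [Matrix.mul_assoc]
    rw [htr, transpose_mul, Matrix.mul_assoc, ← trace_add, ← Matrix.mul_add, add_comm, hq,
      Matrix.mul_zero, trace_zero]
end

section
/- Let n ≥ r ≥ 1, let Φ, Ψ ∈ ℝ^{n×r} satisfy Ψᵀ Φ = I_r, and let (X,Y) ∈ ℝ^{n×r} × ℝ^{n×r}. Then the Sylvester equation A (Φᵀ Φ) + (Ψᵀ Ψ) A = Yᵀ Φ + Ψᵀ X has a unique solution A ∈ ℝ^{r×r}, and with this A the pair (X̂, Ŷ) = (X − Ψ A, Y − Φ Aᵀ) satisfies: (i) Ŷᵀ Φ + Ψᵀ X̂ = 0, and (ii) (X − X̂, Y − Ŷ) is orthogonal, with respect to the inner product ⟨(X₁,Y₁),(X₂,Y₂)⟩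 = Tr(X₁ᵀ X₂) + Tr(Y₁ᵀ Y₂), to every (X',Y') with Y'ᵀ Φ + Ψᵀ X' = 0. Hence (X̂, Ŷ) is the orthogonal projection of (X,Y) onto T = {(X',Y') : Y'ᵀ Φ + Ψᵀ X' = 0}. -/
open Matrix

/-- The Sylvester operator `A ↦ A P + Q A`. -/
def sylvesterMap {m k R : Type*} [Fintype m] [Fintype k] [CommRing R]
    (P : Matrix k k R) (Q : Matrix m m R) : Matrix m k R →ₗ[R] Matrix m k R where
  toFun A := A * P + Q * A
  map_add' A B := by simp only [Matrix.add_mul, Matrix.mul_add]; abel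
  map_smul' c A := by simp

/-- A nonzero square matrix cannot be annihilated by the Sylvester operator with
Gram-matrix coefficients of a biorthogonal pair. -/
theorem eq_zero_of_gram_sylvester_eq_zero {m k : Type*} [Fintype m] [Fintype k] [DecidableEq k]
    {Φ Ψ : Matrix m k ℝ} (hbio : Ψᵀ * Φ = 1) {A : Matrix k k ℝ}
    (hA : A * (Φᵀ * Φ) + (Ψᵀ * Ψ) * A = 0) : A = 0 := by
  have htrace : trace ((Φ * Aᵀ)ᵀ * (Φ * Aᵀ)) + trace ((Ψ * A)ᵀ * (Ψ * A)) = 0 := by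
    have h := congrArg (fun M => trace (Aᵀ * M)) hA
    simp only [Matrix.mul_add, trace_add, Matrix.mul_zero, trace_zero] at h
    rw [trace_mul_comm Aᵀ] at h
    simpa only [transpose_mul, transpose_transpose, Matrix.mul_assoc] using h
  have hΦ := (posSemidef_conjTranspose_mul_self (Φ * Aᵀ)).trace_nonneg
  have hΨ := (posSemidef_conjTranspose_mul_self (Ψ * A)).trace_nonneg
  rw [conjTranspose_eq_transpose_of_trivial] at hΦ hΨ
  have hzero : trace ((Ψ * A)ᴴ * (Ψ * A)) = 0 := by
    rw [conjTranspose_eq_transpose_of_trivial]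
    linarith
  have hΨA : Ψ * A = 0 := trace_conjTranspose_mul_self_eq_zero_iff.mp hzero
  have hbio' : Φᵀ * Ψ = 1 := by
    simpa using congrArg transpose hbio
  calc A = Φᵀ * (Ψ * A) := by rw [← Matrix.mul_assoc, hbio', Matrix.one_mul]
    _ = 0 := by rw [hΨA, Matrix.mul_zero]

/-- Theorem 7 (the biorthogonal manifold): the Sylvester equation has a unique
solution, which yields the orthogonal projection onto the tangent space
`T = {(X',Y') : Y'ᵀ Φ + Ψᵀ X' = 0}` with respect to the trace inner product. -/
theorem biorthogonal_tangent_projection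
    (n r : ℕ) (hrn : r ≤ n) (hr : 1 ≤ r)
    (Φ Ψ : Matrix (Fin n) (Fin r) ℝ) (hbio : Ψᵀ * Φ = 1)
    (X Y : Matrix (Fin n) (Fin r) ℝ) :
    (∃! A : Matrix (Fin r) (Fin r) ℝ,
        A * (Φᵀ * Φ) + (Ψᵀ * Ψ) * A = Yᵀ * Φ + Ψᵀ * X) ∧
      ∀ A : Matrix (Fin r) (Fin r) ℝ,
        A * (Φᵀ * Φ) + (Ψᵀ * Ψ) * A = Yᵀ * Φ + Ψᵀ * X →
          ((Y - Φ * Aᵀ)ᵀ * Φ + Ψᵀ * (X - Ψ * A) = 0 ∧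
            ∀ X' Y' : Matrix (Fin n) (Fin r) ℝ,
              Y'ᵀ * Φ + Ψᵀ * X' = 0 →
                Matrix.trace ((X - (X - Ψ * A))ᵀ * X') +
                  Matrix.trace ((Y - (Y - Φ * Aᵀ))ᵀ * Y') = 0) := by
  refine ⟨?_, fun A hA => ⟨?_, fun X' Y' h => ?_⟩⟩
  · have hinj : Function.Injective (sylvesterMap (Φᵀ * Φ) (Ψᵀ * Ψ)) :=
      (injective_iff_map_eq_zero _).mpr fun A hA => eq_zero_of_gram_sylvester_eq_zero hbio hA
    exact (show Function.Bijective (sylvesterMap (Φᵀ * Φ) (Ψᵀ * Ψ)) from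
      ⟨hinj, LinearMap.surjective_of_injective hinj⟩).existsUnique _
  · rw [transpose_sub, transpose_mul, transpose_transpose, Matrix.sub_mul, Matrix.mul_sub,
      Matrix.mul_assoc, ← Matrix.mul_assoc Ψᵀ, sub_add_sub_comm, hA.symm, sub_self]
  · have hY : trace ((Φ * Aᵀ)ᵀ * Y') = trace (Aᵀ * (Y'ᵀ * Φ)) := by
      rw [← trace_transpose, transpose_mul, transpose_transpose, ← Matrix.mul_assoc,
        trace_mul_comm]
    rw [sub_sub_cancel, sub_sub_cancel, hY, transpose_mul, Matrix.mul_assoc, ← trace_add,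
      ← Matrix.mul_add, add_comm, h, Matrix.mul_zero, trace_zero]
end

section
/- Let n ≥ r ≥ 1 and define Π(Φ̃,Ψ̃) = (Φ̃ (Ψ̃ᵀ Φ̃)⁻¹, Ψ̃) on the open set D₊ = {(Φ̃,Ψ̃) ∈ ℝ^{n×r}×ℝ^{n×r} : det(Ψ̃ᵀ Φ̃) > 0}. Then Π is Fréchet differentiable at every (Φ̃,Ψ̃) ∈ D₊ with derivative DΠ(Φ̃,Ψ̃)(X,Y) = ( X M⁻¹ − Φ̃ M⁻¹ (Yᵀ Φ̃ + Ψ̃ᵀ X) M⁻¹, Y ) where M = Ψ̃ᵀ Φ̃, and this derivative maps onto the tangent space of the biorthogonal manifold at (Φ,Ψ) = Π(Φ̃,Ψ̃): for every (X̂,Ŷ) with Ŷᵀ Φ + Ψᵀ X̂ = 0, one has DΠ(Φ̃,Ψ̃)(X̂ M, Ŷ) = (X̂, Ŷ). -/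
open Matrix

attribute [local instance] Matrix.normedAddCommGroup Matrix.normedSpace

/-- The product of two matrix-valued functions is differentiable, with the Leibniz rule. -/
theorem HasFDerivAt.exists_matrix_mul {E : Type*} [NormedAddCommGroup E] [NormedSpace ℝ E]
    {l m k : Type*} [Fintype l] [Fintype m] [Fintype k]
    {f : E → Matrix l m ℝ} {g : E → Matrix m k ℝ}
    {f' : E →L[ℝ] Matrix l m ℝ} {g' : E →L[ℝ] Matrix m k ℝ} {x : E}
    (hf : HasFDerivAt f f' x) (hg : HasFDerivAt g g' x) :
    ∃ L : E →L[ℝ] Matrix l k ℝ, HasFDerivAt (fun y => f y * g y) L x ∧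
      ∀ v, L v = f x * g' v + f' v * g x :=
  ⟨_, (mulLinearMap (A := ℝ) ℝ).toContinuousBilinearMap.hasFDerivAt_of_bilinear hf hg,
    fun _ => rfl⟩

/-- Matrix inversion is differentiable at every invertible matrix `M`, with derivative
`X ↦ -M⁻¹ X M⁻¹`. -/
theorem Matrix.exists_hasFDerivAt_inv {m : Type*} [Fintype m] [DecidableEq m]
    {M : Matrix m m ℝ} (hM : IsUnit M.det) :
    ∃ L : Matrix m m ℝ →L[ℝ] Matrix m m ℝ,
      HasFDerivAt (fun A : Matrix m m ℝ => A⁻¹) L M ∧ ∀ X, L X = -(M⁻¹ * X * M⁻¹) := by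
  obtain ⟨u, rfl⟩ := (Matrix.isUnit_iff_isUnit_det M).2 hM
  have h := @hasFDerivAt_ringInverse ℝ _ (Matrix m m ℝ) Matrix.linftyOpNormedRing _
    Matrix.linftyOpNormedAlgebra u
  rw [← funext Matrix.nonsing_inv_eq_ringInverse] at h
  refine ⟨_, h, fun X => ?_⟩
  rw [← Matrix.coe_units_inv]
  rfl

/-- Theorem 8 (over-parametrization): the map `Π(Φ̃,Ψ̃) = (Φ̃(Ψ̃ᵀΦ̃)⁻¹, Ψ̃)` is Fréchet
differentiable on `D₊`, with the stated derivative, and its derivative maps onto the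
tangent space of the biorthogonal manifold at `Π(Φ̃,Ψ̃)`. -/
theorem overparametrization_submersion
    (n r : ℕ) (hrn : r ≤ n) (hr : 1 ≤ r)
    (Φt Ψt : Matrix (Fin n) (Fin r) ℝ)
    (hdet : 0 < (Ψtᵀ * Φt).det) :
    ∃ L : (Matrix (Fin n) (Fin r) ℝ × Matrix (Fin n) (Fin r) ℝ) →L[ℝ]
        (Matrix (Fin n) (Fin r) ℝ × Matrix (Fin n) (Fin r) ℝ),
      HasFDerivAt
        (fun p : Matrix (Fin n) (Fin r) ℝ × Matrix (Fin n) (Fin r) ℝ =>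
          (p.1 * (p.2ᵀ * p.1)⁻¹, p.2))
        L (Φt, Ψt) ∧
      (∀ X Y : Matrix (Fin n) (Fin r) ℝ,
        L (X, Y) =
          (X * (Ψtᵀ * Φt)⁻¹ -
            Φt * (Ψtᵀ * Φt)⁻¹ * (Yᵀ * Φt + Ψtᵀ * X) * (Ψtᵀ * Φt)⁻¹, Y)) ∧
      (∀ Xh Yh : Matrix (Fin n) (Fin r) ℝ,
        Yhᵀ * (Φt * (Ψtᵀ * Φt)⁻¹) + Ψtᵀ * Xh = 0 →
          L (Xh * (Ψtᵀ * Φt), Yh) = (Xh, Yh)) := by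
  have hM : IsUnit (Ψtᵀ * Φt).det := hdet.ne'.isUnit
  have hfst := hasFDerivAt_fst (𝕜 := ℝ) (p := (Φt, Ψt))
  have hsnd := hasFDerivAt_snd (𝕜 := ℝ) (p := (Φt, Ψt))
  have htr := (Matrix.transposeLinearEquiv (Fin n) (Fin r) ℝ
    ℝ).toLinearMap.toContinuousLinearMap.hasFDerivAt.comp (Φt, Ψt) hsnd
  obtain ⟨L₁, h₁, hL₁⟩ := htr.exists_matrix_mul hfst
  obtain ⟨L₂, h₂, hL₂⟩ := Matrix.exists_hasFDerivAt_inv hM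
  obtain ⟨L₃, h₃, hL₃⟩ := hfst.exists_matrix_mul (HasFDerivAt.comp (Φt, Ψt) h₂ h₁)
  have hL : ∀ X Y : Matrix (Fin n) (Fin r) ℝ,
      L₃ (X, Y) = X * (Ψtᵀ * Φt)⁻¹ -
        Φt * (Ψtᵀ * Φt)⁻¹ * (Yᵀ * Φt + Ψtᵀ * X) * (Ψtᵀ * Φt)⁻¹ := by
    intro X Y
    have h : L₁ (X, Y) = Ψtᵀ * X + Yᵀ * Φt := hL₁ (X, Y)
    have h' : L₃ (X, Y) = Φt * L₂ (L₁ (X, Y)) + X * (Ψtᵀ * Φt)⁻¹ := hL₃ (X, Y)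
    rw [h', hL₂, h, add_comm (Ψtᵀ * X), Matrix.mul_neg, neg_add_eq_sub]
    simp only [Matrix.mul_assoc]
  refine ⟨L₃.prod (ContinuousLinearMap.snd ℝ _ _), h₃.prodMk hsnd,
    fun X Y => Prod.ext (hL X Y) rfl, fun Xh Yh h => Prod.ext ((hL _ _).trans ?_) rfl⟩
  have hzero : Yhᵀ * Φt + Ψtᵀ * (Xh * (Ψtᵀ * Φt)) = 0 := by
    have h' := congrArg (· * (Ψtᵀ * Φt)) h
    simp only [Matrix.add_mul, Matrix.zero_mul] at h'
    rwa [← Matrix.mul_assoc Yhᵀ, Matrix.nonsing_inv_mul_cancel_right _ _ hM,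
      Matrix.mul_assoc Ψtᵀ Xh] at h'
  rw [hzero, Matrix.mul_nonsing_inv_cancel_right _ _ hM, Matrix.mul_zero, Matrix.zero_mul,
    sub_zero]
end

section
/- Let n > r ≥ 1. Then the set D₊ = {(Φ̃, Ψ̃) ∈ ℝ^{n×r} × ℝ^{n×r} : det(Ψ̃ᵀ Φ̃) > 0} is path-connected. -/
open Matrix

section PositiveDeterminant

variable {ι : Type*} [Fintype ι] [DecidableEq ι]

theorem joinedIn_det_pos_mul {A B C D : Matrix ι ι ℝ}
    (h₁ : JoinedIn {M : Matrix ι ι ℝ | 0 < M.det} A B)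
    (h₂ : JoinedIn {M : Matrix ι ι ℝ | 0 < M.det} C D) :
    JoinedIn {M : Matrix ι ι ℝ | 0 < M.det} (A * C) (B * D) := by
  refine (h₁.mul h₂).mono ?_
  rintro _ ⟨M, hM, N, hN, rfl⟩
  simpa using mul_pos hM hN

theorem joinedIn_det_pos_one_transvection {i j : ι} (hij : i ≠ j) (c : ℝ) :
    JoinedIn {M : Matrix ι ι ℝ | 0 < M.det} 1 (transvection i j c) := by
  refine JoinedIn.ofLine (f := fun t : ℝ ↦ 1 + t • single i j c) (by fun_prop) (by simp)
    (by simp [transvection]) ?_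
  rintro _ ⟨t, -, rfl⟩
  have := det_transvection_of_ne i j hij (t * c)
  simp only [transvection] at this
  simp [smul_single, this]

theorem diagonal_eq_prod_transvection {F : Type*} [Field F] {i j : ι} (hij : i ≠ j) {c : F}
    (hc : c ≠ 0) :
    diagonal (fun k ↦ if k = i then c else if k = j then c⁻¹ else 1) =
      transvection i j c * transvection j i (-c⁻¹) * transvection i j c *
        transvection i j (-1) * transvection j i 1 * transvection i j (-1) := by
  have h : diagonal (fun k ↦ if k = i then c else if k = j then c⁻¹ else 1) =
      1 + single i i (c - 1) + single j j (c⁻¹ - 1) := by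
    ext a b
    simp only [diagonal_apply, Matrix.add_apply, one_apply, single_apply]
    grind
  rw [h]
  simp only [transvection, Matrix.mul_add, Matrix.add_mul, Matrix.mul_one, Matrix.one_mul, single_mul_single_same,
    single_mul_single_of_ne _ _ _ _ hij, single_mul_single_of_ne _ _ _ _ hij.symm]
  ext a b
  simp only [Matrix.add_apply, one_apply, single_apply, Matrix.zero_apply]
  by_cases h1 : i = a <;> by_cases h2 : j = a <;> by_cases h3 : i = b <;> by_cases h4 : j = b <;>
    simp [h1, h2, h3, h4, hc] <;> grind

theorem joinedIn_det_pos_one_specialLinearGroup [Nontrivial ι]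
    (A : SpecialLinearGroup ι ℝ) :
    JoinedIn {M : Matrix ι ι ℝ | 0 < M.det} 1 A := by
  refine SpecialLinearGroup.diagonal_transvection_induction'
    (fun A ↦ JoinedIn {M : Matrix ι ι ℝ | 0 < M.det} 1 (A : Matrix ι ι ℝ)) A ?_
    (fun i j hij c ↦ joinedIn_det_pos_one_transvection hij c)
    (fun A B hA hB ↦ by simpa using joinedIn_det_pos_mul hA hB)
  intro i j hij c hc
  rw [Matrix.SpecialLinearGroup.diag2n_coe, diagonal_eq_prod_transvection hij hc]
  have hc := joinedIn_det_pos_one_transvection hij c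
  have hneg := joinedIn_det_pos_one_transvection hij (-1)
  simpa using joinedIn_det_pos_mul (joinedIn_det_pos_mul (joinedIn_det_pos_mul
    (joinedIn_det_pos_mul (joinedIn_det_pos_mul hc
      (joinedIn_det_pos_one_transvection hij.symm (-c⁻¹))) hc) hneg)
    (joinedIn_det_pos_one_transvection hij.symm 1)) hneg

theorem joinedIn_det_pos_one_diagonal {D : ι → ℝ} (hD : ∀ i, 0 < D i) :
    JoinedIn {M : Matrix ι ι ℝ | 0 < M.det} 1 (diagonal D) := by
  refine JoinedIn.ofLine (f := fun t : ℝ ↦ diagonal (fun i ↦ (1 - t) + t * D i))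
    (by fun_prop) (by simp) (by simp) ?_
  rintro _ ⟨t, ⟨h0, h1⟩, rfl⟩
  simp only [Set.mem_ofPred_eq, det_diagonal]
  refine Finset.prod_pos fun i _ ↦ ?_
  have := hD i
  rcases h0.eq_or_lt with rfl | h0
  · simp
  · have := mul_pos h0 this
    linarith

theorem joinedIn_det_pos_one {A : Matrix ι ι ℝ} (hA : 0 < A.det) :
    JoinedIn {M : Matrix ι ι ℝ | 0 < M.det} 1 A := by
  rcases subsingleton_or_nontrivial ι with h | h
  · have hdiag : A = diagonal (fun i ↦ A i i) := by
      ext i j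
      simp [Subsingleton.elim j i]
    rw [hdiag]
    exact joinedIn_det_pos_one_diagonal fun i ↦ by rwa [← det_eq_elem_of_subsingleton A i]
  · obtain ⟨i₀⟩ := (inferInstance : Nonempty ι)
    let D : ι → ℝ := Function.update 1 i₀ A.det
    have hD : ∀ i, 0 < D i := fun i ↦ by
      by_cases hi : i = i₀
      · subst hi; simpa [D] using hA
      · simp [D, hi]
    have hdet : (diagonal D).det = A.det := by
      simp [D, det_diagonal, Finset.prod_update_of_mem]
    have hB : ((diagonal D)⁻¹ * A).det = 1 := by
      rw [det_mul, det_nonsing_inv, hdet, Ring.inverse_eq_inv', inv_mul_cancel₀ hA.ne']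
    have h := joinedIn_det_pos_mul (joinedIn_det_pos_one_diagonal hD)
      (joinedIn_det_pos_one_specialLinearGroup ⟨_, hB⟩)
    rwa [one_mul, mul_nonsing_inv_cancel_left _ _ (by rw [hdet]; exact hA.ne'.isUnit)] at h

end PositiveDeterminant

section FullColumnRank

variable {m k : Type*} [Fintype m] [Fintype k]

theorem mulVec_injective_of_isUnit_det_mul [DecidableEq k] {F : Type*} [Field F]
    {A : Matrix k m F} {B : Matrix m k F} (h : IsUnit (A * B).det) : Function.Injective B.mulVec := by
  have h' := mulVec_injective_of_isUnit ((isUnit_iff_isUnit_det _).2 h)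
  refine Function.Injective.of_comp (f := A.mulVec) ?_
  convert h' using 1
  ext1 x
  simp

theorem exists_isUnit_det_mul_eq [DecidableEq m] {F : Type*} [Field F]
    {E P : Matrix m k F}
    (hE : Function.Injective E.mulVec) (hP : Function.Injective P.mulVec) :
    ∃ A : Matrix m m F, IsUnit A.det ∧ A * E = P := by
  let e := LinearEquiv.ofInjective E.mulVecLin hE
  let p := LinearEquiv.ofInjective P.mulVecLin hP
  obtain ⟨g, hg⟩ := Submodule.exists_linearEquiv_restrict_eq (e.symm ≪≫ₗ p)
  refine ⟨LinearMap.toMatrix' g.toLinearMap, ?_, ?_⟩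
  · rw [LinearMap.det_toMatrix']
    exact g.isUnit_det'
  · apply mulVec_injective
    ext1 x
    have h := hg (e x)
    simp only [LinearEquiv.trans_apply, LinearEquiv.symm_apply_apply] at h
    rw [← mulVec_mulVec, LinearMap.toMatrix'_mulVec]
    exact h.symm

theorem exists_det_pos_mul_eq [DecidableEq m] {E P : Matrix m k ℝ}
    (hE : Function.Injective E.mulVec) (hP : Function.Injective P.mulVec)
    {i₀ : m} (hrow : ∀ j, E i₀ j = 0) :
    ∃ A : Matrix m m ℝ, 0 < A.det ∧ A * E = P := by
  obtain ⟨A, hA, hAE⟩ := exists_isUnit_det_mul_eq hE hP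
  rcases lt_or_gt_of_ne hA.ne_zero with hneg | hpos
  · let D : Matrix m m ℝ := diagonal (Function.update 1 i₀ (-1))
    have hD : D.det = -1 := by simp [D, det_diagonal, Finset.prod_update_of_mem]
    have hDE : D * E = E := by
      ext i j
      by_cases hi : i = i₀
      · subst hi; simp [D, hrow]
      · simp [D, hi]
    exact ⟨A * D, by rw [det_mul, hD]; linarith, by rw [Matrix.mul_assoc, hDE, hAE]⟩
  · exact ⟨A, hpos, hAE⟩

theorem posDef_transpose_mul_self {P : Matrix m k ℝ} (hP : Function.Injective P.mulVec) :
    (Pᵀ * P).PosDef := by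
  simpa using PosDef.conjTranspose_mul_self P hP

theorem joinedIn_det_transpose_mul_pos_diag [DecidableEq k]
    {P Q : Matrix m k ℝ} (h : 0 < (Qᵀ * P).det) :
    JoinedIn {p : Matrix m k ℝ × Matrix m k ℝ | 0 < (p.2ᵀ * p.1).det} (P, Q) (Q, Q) := by
  set G := Qᵀ * P with hG
  have hGinv : 0 < (G⁻¹).det := by
    rw [det_nonsing_inv, Ring.inverse_eq_inv']
    exact inv_pos.2 h
  have hnormalize : JoinedIn {p : Matrix m k ℝ × Matrix m k ℝ | 0 < (p.2ᵀ * p.1).det}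
      (P, Q) (P * G⁻¹, Q) := by
    have := ((joinedIn_det_pos_one hGinv).map
      (f := fun B : Matrix k k ℝ ↦ (P * B, Q)) (by fun_prop)).mono
      (V := {p : Matrix m k ℝ × Matrix m k ℝ | 0 < (p.2ᵀ * p.1).det}) (by
        rintro _ ⟨B, hB, rfl⟩
        simpa [← Matrix.mul_assoc, ← hG] using mul_pos h hB)
    simpa using this
  refine hnormalize.trans (JoinedIn.ofLine
    (f := fun t : ℝ ↦ ((1 - t) • (P * G⁻¹) + t • Q, Q)) (by fun_prop) (by simp) (by simp) ?_)
  have hone : Qᵀ * (P * G⁻¹) = 1 := by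
    rw [← Matrix.mul_assoc, ← hG, mul_nonsing_inv _ h.ne'.isUnit]
  have hQ : (Qᵀ * Q).PosDef := posDef_transpose_mul_self <| by
    refine mulVec_injective_of_isUnit_det_mul (A := Pᵀ) ?_
    rw [← det_transpose, transpose_mul, transpose_transpose]
    exact h.ne'.isUnit
  rintro _ ⟨t, ⟨h0, h1⟩, rfl⟩
  simp only [Set.mem_ofPred_eq, Matrix.mul_add, Matrix.mul_smul, hone]
  rcases h0.eq_or_lt with rfl | h0
  · simp
  · exact (PosDef.posSemidef_add (PosSemidef.one.smul (sub_nonneg.2 h1)) (hQ.smul h0)).det_pos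

end FullColumnRank

/-- Proposition 9, first part: for `n > r`, the over-parametrization domain
`D₊ = {(Φ̃,Ψ̃) : det(Ψ̃ᵀΦ̃) > 0}` is path-connected. -/
theorem overparametrization_domain_path_connected
    (n r : ℕ) (hrn : r < n) (hr : 1 ≤ r) :
    IsPathConnected
      {p : Matrix (Fin n) (Fin r) ℝ × Matrix (Fin n) (Fin r) ℝ |
        0 < (p.2ᵀ * p.1).det} := by
  let E : Matrix (Fin n) (Fin r) ℝ := (1 : Matrix (Fin n) (Fin n) ℝ).submatrix id (Fin.castLE hrn.le)
  have hEE : Eᵀ * E = 1 := by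
    ext i j
    simp [E, Matrix.mul_apply, one_apply]
  have hE : Function.Injective E.mulVec :=
    mulVec_injective_of_isUnit_det_mul (A := Eᵀ) (by simp [hEE])
  have hrow : ∀ j, E ⟨r, hrn⟩ j = 0 := fun j ↦ by
    simp [E, one_apply, Fin.ext_iff, j.isLt.ne']
  refine ⟨(E, E), by simp [hEE], ?_⟩
  rintro ⟨P, Q⟩ h
  refine JoinedIn.trans ?_ (joinedIn_det_transpose_mul_pos_diag h).symm
  have hQ : Function.Injective Q.mulVec := by
    refine mulVec_injective_of_isUnit_det_mul (A := Pᵀ) ?_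
    rw [← det_transpose, transpose_mul, transpose_transpose]
    exact h.ne'.isUnit
  obtain ⟨A, hA, rfl⟩ := exists_det_pos_mul_eq hE hQ hrow
  have := ((joinedIn_det_pos_one hA).map
    (f := fun B : Matrix (Fin n) (Fin n) ℝ ↦ (B * E, B * E)) (by fun_prop)).mono
    (V := {p : Matrix (Fin n) (Fin r) ℝ × Matrix (Fin n) (Fin r) ℝ | 0 < (p.2ᵀ * p.1).det}) (by
      rintro _ ⟨B, hB, rfl⟩
      refine (posDef_transpose_mul_self ?_).det_pos
      have hB' : Function.Injective B.mulVec :=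
        mulVec_injective_of_isUnit ((isUnit_iff_isUnit_det _).2 (ne_of_gt hB).isUnit)
      convert hB'.comp hE using 1
      ext1 x
      simp)
  simpa using this
end

section
/- Let 0 < α < π/4 and set a = 1/sin²(α) − 1/cos²(α) and b = 1/sin²(α) + 1/cos²(α), and define σ₊, σ₋ : ℝ → ℝ by σ₊(x) = (b x)/a − √2/(a sin(α)) + (1/a)·√( (2x/(sin(α)cos(α)) − √2/cos(α))² + 2a ) and σ₋(x) = (b x)/a + √2/(a sin(α)) − (1/a)·√( (2x/(sin(α)cos(α)) + √2/cos(α))² + 2a ). Then a > 0, σ₊(0) = σ₋(0) = 0, and for every x ∈ ℝ: σ₋(σ₊(x)) = x and σ₊(σ₋(x)) = x. -/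
open Real

/-- Two points related by the upper branch of the hyperbola are related by the lower branch
after exchanging the coordinates. -/
theorem sqrt_eq_of_upper_branch {p q r x y : ℝ} (hq : 0 < q) (hpq : q < p) (hr : r ^ 2 = 2)
    (h : (p ^ 2 - q ^ 2) * y = (p ^ 2 + q ^ 2) * x - r * p +
      √((2 * p * q * x - r * q) ^ 2 + 2 * (p ^ 2 - q ^ 2))) :
    √((2 * p * q * y + r * q) ^ 2 + 2 * (p ^ 2 - q ^ 2)) =
      (p ^ 2 + q ^ 2) * y + r * p - (p ^ 2 - q ^ 2) * x := by
  have ha : 0 < p ^ 2 - q ^ 2 := by nlinarith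
  set u := 2 * p * q * x - r * q with hu
  set S := √(u ^ 2 + 2 * (p ^ 2 - q ^ 2)) with hS
  have hS2 : S ^ 2 = u ^ 2 + 2 * (p ^ 2 - q ^ 2) := Real.sq_sqrt (by positivity)
  have hSu : |u| ≤ S := Real.abs_le_sqrt (by linarith)
  have hcurve : (p ^ 2 - q ^ 2) * (x ^ 2 + y ^ 2) - 2 * (p ^ 2 + q ^ 2) * x * y
      + 2 * r * p * (y - x) = 0 := by
    apply mul_left_cancel₀ ha.ne'
    have hSe : S = (p ^ 2 - q ^ 2) * y - (p ^ 2 + q ^ 2) * x + r * p := by linarith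
    rw [hSe, hu] at hS2
    linear_combination hS2 - (p ^ 2 - q ^ 2) * hr
  have hbranch : 0 ≤ (p ^ 2 + q ^ 2) * y + r * p - (p ^ 2 - q ^ 2) * x := by
    refine (mul_nonneg_iff_of_pos_left ha).1 ?_
    have hmul : (p ^ 2 - q ^ 2) * ((p ^ 2 + q ^ 2) * y + r * p - (p ^ 2 - q ^ 2) * x) =
        2 * p * q * (u + S) + (p - q) ^ 2 * S := by
      rw [hu]
      linear_combination (p ^ 2 + q ^ 2) * h
    have hp : 0 < p := hq.trans hpq
    have huS : 0 ≤ u + S := by linarith [neg_abs_le u]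
    rw [hmul]
    positivity
  rw [← Real.sqrt_sq hbranch]
  congr 1
  linear_combination (p ^ 2 - q ^ 2) * (-hcurve - hr)

/-- The smooth invertible activation functions `σ₊` and `σ₋` of the constrained
autoencoder are mutually inverse and fix the origin. -/
theorem activation_functions_inverse
    (α : ℝ) (hα0 : 0 < α) (hα : α < π / 4)
    (a b : ℝ)
    (ha : a = 1 / sin α ^ 2 - 1 / cos α ^ 2)
    (hb : b = 1 / sin α ^ 2 + 1 / cos α ^ 2)
    (σp σm : ℝ → ℝ)
    (hσp : ∀ x, σp x =
      b * x / a - Real.sqrt 2 / (a * sin α) +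
        (1 / a) * Real.sqrt ((2 * x / (sin α * cos α) - Real.sqrt 2 / cos α) ^ 2 + 2 * a))
    (hσm : ∀ x, σm x =
      b * x / a + Real.sqrt 2 / (a * sin α) -
        (1 / a) * Real.sqrt ((2 * x / (sin α * cos α) + Real.sqrt 2 / cos α) ^ 2 + 2 * a)) :
    0 < a ∧ σp 0 = 0 ∧ σm 0 = 0 ∧ ∀ x : ℝ, σm (σp x) = x ∧ σp (σm x) = x := by
  have hs : 0 < sin α := sin_pos_of_pos_of_lt_pi hα0 (by linarith [pi_pos])
  have hc : 0 < cos α := cos_pos_of_mem_Ioo ⟨by linarith [pi_pos], by linarith [pi_pos]⟩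
  have hsc : sin α < cos α := by
    rw [← sin_pi_div_two_sub]
    exact sin_lt_sin_of_lt_of_le_pi_div_two (by linarith [pi_pos]) (by linarith) (by linarith)
  obtain ⟨p, hp⟩ : ∃ p, p = (sin α)⁻¹ := ⟨_, rfl⟩
  obtain ⟨q, hq⟩ : ∃ q, q = (cos α)⁻¹ := ⟨_, rfl⟩
  have hq0 : 0 < q := hq ▸ inv_pos.2 hc
  have hqp : q < p := by rw [hp, hq]; exact inv_strictAnti₀ hs hsc
  have ha' : a = p ^ 2 - q ^ 2 := by simp [ha, hp, hq]
  have hb' : b = p ^ 2 + q ^ 2 := by simp [hb, hp, hq]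
  have ha0 : 0 < a := by rw [ha']; nlinarith
  have hr : √(2 : ℝ) ^ 2 = 2 := Real.sq_sqrt (by norm_num)
  have hmul (x : ℝ) : a * σp x = b * x - √2 * p + √((2 * p * q * x - √2 * q) ^ 2 + 2 * a) := by
    have harg : 2 * x / (sin α * cos α) - √2 / cos α = 2 * p * q * x - √2 * q := by
      rw [hp, hq]; field_simp
    rw [hσp, harg, hp]
    field_simp
  have hodd (x : ℝ) : σm x = -σp (-x) := by
    have harg : (2 * -x / (sin α * cos α) - √2 / cos α) ^ 2 =
        (2 * x / (sin α * cos α) + √2 / cos α) ^ 2 := by ring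
    rw [hσm, hσp, harg]
    ring
  have hzero : σp 0 = 0 := by
    apply mul_left_cancel₀ ha0.ne'
    have harg : (2 * p * q * 0 - √2 * q) ^ 2 + 2 * a = (√2 * p) ^ 2 := by
      rw [ha']; linear_combination (q ^ 2 - p ^ 2) * hr
    rw [hmul, harg, Real.sqrt_sq (mul_nonneg (Real.sqrt_nonneg _) (hq0.trans hqp).le)]
    ring
  have hinv (x : ℝ) : σm (σp x) = x := by
    have hx := hmul x
    rw [ha', hb'] at hx
    have hsqrt := sqrt_eq_of_upper_branch hq0 hqp hr hx
    have hy := hmul (-σp x)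
    have harg : (2 * p * q * -σp x - √2 * q) ^ 2 = (2 * p * q * σp x + √2 * q) ^ 2 := by ring
    rw [harg, ha', hsqrt, ← ha', hb'] at hy
    rw [hodd]
    apply mul_left_cancel₀ ha0.ne'
    linear_combination -hy
  refine ⟨ha0, hzero, by simp [hodd, hzero], fun x => ⟨hinv x, ?_⟩⟩
  have hneg := hinv (-x)
  rw [hodd] at hneg
  rw [hodd]
  linarith
end
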